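/- Every subset S of the set C of exceptional vectors with |S| = 11 such that d·e ∈ {1, 2} for all distinct d, e ∈ S is contained in a subset S′ of C with |S′| = 12 such that d·e ∈ {1, 2} for all distinct d, e ∈ S′. In other words, there are no maximal such cliques of size 11. -/

import Mathlib

/-- The bilinear form on `Λ = ℤ⁹`: `d·e = d₀e₀ − Σ_{i=1}^{8} dᵢeᵢ`. -/
def dot (d e : Fin 9 → ℤ) : ℤ := d 0 * e 0 - ∑ i : Fin 8, d i.succ * e i.succ

/-- The canonical class `K = (−3, 1, 1, 1, 1, 1, 1, 1, 1)`. -/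
def KK : Fin 9 → ℤ := ![-3, 1, 1, 1, 1, 1, 1, 1, 1]

/-- A vector is exceptional if `d·d = −1` and `d·K = −1`. -/
def IsExceptional (d : Fin 9 → ℤ) : Prop := dot d d = -1 ∧ dot d KK = -1

/-- The form `dot` as a bilinear map. -/
def dotForm : (Fin 9 → ℤ) →ₗ[ℤ] (Fin 9 → ℤ) →ₗ[ℤ] ℤ :=
  LinearMap.mk₂ ℤ dot
    (fun a b c => by simp only [dot, Fin.sum_univ_succ, Pi.add_apply]; ring)
    (fun a b c => by simp only [dot, Fin.sum_univ_succ, Pi.smul_apply, smul_eq_mul]; ring)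
    (fun a b c => by simp only [dot, Fin.sum_univ_succ, Pi.add_apply]; ring)
    (fun a b c => by simp only [dot, Fin.sum_univ_succ, Pi.smul_apply, smul_eq_mul]; ring)

lemma dot_comm (a b : Fin 9 → ℤ) : dot a b = dot b a := by
  simp only [dot, mul_comm]

lemma dot_add_left (a b c : Fin 9 → ℤ) : dot (a + b) c = dot a c + dot b c :=
  dotForm.map_add₂ a b c

lemma dot_add_right (a b c : Fin 9 → ℤ) : dot a (b + c) = dot a b + dot a c :=
  (dotForm a).map_add b c

lemma dot_smul_left (k : ℤ) (a c : Fin 9 → ℤ) : dot (k • a) c = k * dot a c :=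
  dotForm.map_smul₂ k a c

lemma dot_smul_right (k : ℤ) (a c : Fin 9 → ℤ) : dot a (k • c) = k * dot a c :=
  (dotForm a).map_smul k c

lemma dot_neg_left (a c : Fin 9 → ℤ) : dot (-a) c = -dot a c :=
  dotForm.map_neg₂ a c

lemma dot_neg_right (a c : Fin 9 → ℤ) : dot a (-c) = -dot a c :=
  (dotForm a).map_neg c

lemma dot_zero_left (c : Fin 9 → ℤ) : dot 0 c = 0 :=
  dotForm.map_zero₂ c

lemma dot_sum_left {ι : Type*} (s : Finset ι) (f : ι → Fin 9 → ℤ) (c : Fin 9 → ℤ) :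
    dot (∑ i ∈ s, f i) c = ∑ i ∈ s, dot (f i) c :=
  LinearMap.map_sum₂ dotForm s f c

lemma dot_sum_right {ι : Type*} (s : Finset ι) (f : ι → Fin 9 → ℤ) (a : Fin 9 → ℤ) :
    dot a (∑ i ∈ s, f i) = ∑ i ∈ s, dot a (f i) :=
  map_sum (dotForm a) f s

lemma dot_KK_self : dot KK KK = 1 := by decide

/-- The form is negative definite on the orthogonal complement of `K`. -/
lemma eq_zero_of_dot_self_nonneg {v : Fin 9 → ℤ} (hK : dot v KK = 0) (hv : 0 ≤ dot v v) :
    v = 0 := by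
  have hcs := sq_sum_le_card_mul_sum_sq (s := Finset.univ) (f := fun i : Fin 8 => v i.succ)
  have hKK : ∀ i : Fin 8, KK i.succ = 1 := by decide
  have h0 : KK 0 = -3 := rfl
  simp only [dot, hKK, h0, mul_one] at hK
  simp only [dot, ← sq] at hv
  simp only [Finset.card_univ, Fintype.card_fin, Nat.cast_ofNat] at hcs
  have hnn : 0 ≤ ∑ i : Fin 8, v i.succ ^ 2 := Finset.sum_nonneg fun i _ => sq_nonneg _
  have hsum : ∑ i : Fin 8, v i.succ = -3 * v 0 := by linarith
  rw [hsum] at hcs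
  have hz : ∑ i : Fin 8, v i.succ ^ 2 = 0 := by nlinarith
  have hv0 : v 0 = 0 := by
    have : v 0 ^ 2 ≤ 0 := by nlinarith
    exact pow_eq_zero_iff two_ne_zero |>.mp (le_antisymm this (sq_nonneg _))
  rw [Finset.sum_eq_zero_iff_of_nonneg fun i _ => sq_nonneg _] at hz
  funext i
  refine Fin.cases hv0 (fun j => ?_) i
  simpa using hz j (Finset.mem_univ j)

/-- The orthogonal complement of `K` is an even lattice. -/
lemma even_dot_self {v : Fin 9 → ℤ} (hK : dot v KK = 0) : Even (dot v v) := by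
  have key : ∀ x : ℤ, (2 : ℤ) ∣ x * x - x := fun x =>
    by simpa [mul_sub] using (Int.even_mul_pred_self x).two_dvd
  have hKK : ∀ i : Fin 8, KK i.succ = 1 := by decide
  have h0 : KK 0 = -3 := rfl
  simp only [dot, hKK, h0, mul_one] at hK
  have h1 : (2 : ℤ) ∣ ∑ i : Fin 8, (v i.succ * v i.succ - v i.succ) :=
    Finset.dvd_sum fun i _ => key _
  rw [Finset.sum_sub_distrib] at h1
  have h2 := key (v 0)
  rw [even_iff_two_dvd]
  unfold dot
  omega

/-! ### Gram determinants -/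

/-- The Gram matrix of a family of vectors. -/
def gram {ι : Type*} (f : ι → Fin 9 → ℤ) : Matrix ι ι ℤ := .of fun i j => dot (f i) (f j)

/-- The coordinate matrix of a family of nine vectors. -/
def coordMatrix {ι : Type*} (f : ι → Fin 9 → ℤ) (e : ι ≃ Fin 9) : Matrix ι ι ℤ :=
  .of fun i j => f i (e j)

section Gram

variable {ι κ : Type*} [Fintype ι] [DecidableEq ι] [Fintype κ]

/-- The form `dot` is unimodular: the Gram determinant of nine vectors is a square. -/
lemma det_gram_eq_sq (f : ι → Fin 9 → ℤ) (e : ι ≃ Fin 9) :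
    (gram f).det = (coordMatrix f e).det ^ 2 := by
  let J : Fin 9 → ℤ := ![1, -1, -1, -1, -1, -1, -1, -1, -1]
  have hJ : ∀ a b : Fin 9 → ℤ, dot a b = ∑ j, a j * J j * b j := by
    intro a b
    have hs : ∀ i : Fin 8, J i.succ = -1 := by decide
    rw [Fin.sum_univ_succ]
    simp only [hs, dot, mul_neg, mul_one, neg_mul, Finset.sum_neg_distrib]
    simp [J, sub_eq_add_neg]
  have hprod : gram f =
      coordMatrix f e * Matrix.diagonal (J ∘ e) * (coordMatrix f e).transpose := by
    ext i j
    rw [Matrix.mul_apply]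
    simp only [gram, coordMatrix, Matrix.of_apply, Matrix.mul_diagonal, Matrix.transpose_apply,
      Function.comp_apply, hJ]
    exact (Equiv.sum_comp e fun k => f i k * J k * f j k).symm
  have hdet : ∏ i, (J ∘ e) i = 1 := by
    simp only [Function.comp_apply]
    rw [Equiv.prod_comp e J]
    decide
  rw [hprod, Matrix.det_mul, Matrix.det_mul, Matrix.det_transpose, Matrix.det_diagonal, hdet]
  ring

lemma det_gram_sumElim [DecidableEq κ] {f : ι → Fin 9 → ℤ} {g : κ → Fin 9 → ℤ}
    (h : ∀ i j, dot (f i) (g j) = 0) :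
    (gram (Sum.elim f g)).det = (gram f).det * (gram g).det := by
  have : gram (Sum.elim f g) = Matrix.fromBlocks (gram f) 0 0 (gram g) := by
    ext (i | i) (j | j)
    · rfl
    · exact h i j
    · exact (dot_comm _ _).trans (h j i)
    · rfl
  rw [this, Matrix.det_fromBlocks_zero₁₂]

/-- Nine vectors with even determinant are linearly dependent modulo 2. -/
lemma exists_odd_combination_of_even_det (f : ι → Fin 9 → ℤ) (e : ι ≃ Fin 9)
    (h : Even (coordMatrix f e).det) :
    ∃ c : ι → ℤ, (∃ i, Odd (c i)) ∧ ∃ q : Fin 9 → ℤ, ∑ i, c i • f i = (2 : ℤ) • q := by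
  have hdet : ((coordMatrix f e).map (Int.castRingHom (ZMod 2))).det = 0 := by
    rw [← RingHom.mapMatrix_apply, ← RingHom.map_det, eq_intCast,
      ZMod.intCast_zmod_eq_zero_iff_dvd _ 2 |>.mpr]
    exact_mod_cast h.two_dvd
  obtain ⟨c, hc0, hc⟩ := Matrix.exists_vecMul_eq_zero_iff.mpr hdet
  obtain ⟨i, hi⟩ := Function.ne_iff.mp hc0
  refine ⟨fun i => (c i).val, ⟨i, ?_⟩, ?_⟩
  · rw [← Int.not_even_iff_odd, even_iff_two_dvd]
    intro hd
    exact hi (by simpa using (ZMod.intCast_zmod_eq_zero_iff_dvd ((c i).val : ℤ) 2).mpr hd)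
  · have hdvd : ∀ j, (2 : ℤ) ∣ (∑ i, ((c i).val : ℤ) • f i) j := by
      intro j
      have := congrFun hc (e.symm j)
      rw [← Nat.cast_ofNat, ← ZMod.intCast_zmod_eq_zero_iff_dvd _ 2]
      simpa [-zsmul_eq_mul, Matrix.vecMul, dotProduct, coordMatrix] using this
    choose q hq using hdvd
    exact ⟨q, funext hq⟩

/-- Fewer than nine vectors do not span `ℤ⁹` modulo 2. -/
lemma exists_not_combination_mod_two (f : κ → Fin 9 → ℤ) (h : Fintype.card κ < 9) :
    ∃ w : Fin 9 → ℤ, ∀ (c : κ → ℤ) (q : Fin 9 → ℤ), w ≠ ∑ i, c i • f i + (2 : ℤ) • q := by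
  let F : κ → Fin 9 → ZMod 2 := fun i j => (f i j : ZMod 2)
  have hspan : Submodule.span (ZMod 2) (Set.range F) ≠ ⊤ := by
    intro htop
    have h1 := finrank_range_le_card (R := ZMod 2) F
    rw [Set.finrank, htop, finrank_top, Module.finrank_fin_fun] at h1
    omega
  obtain ⟨u, hu⟩ := SetLike.exists_not_mem_of_ne_top _ hspan rfl
  refine ⟨fun j => ((u j).val : ℤ), fun c q hw => hu ?_⟩
  have : u = ∑ i, (c i : ZMod 2) • F i := by
    funext j
    have h2 := congrArg (Int.cast : ℤ → ZMod 2) (congrFun hw j)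
    have h20 : (2 : ZMod 2) = 0 := rfl
    simpa [-zsmul_eq_mul, F, h20] using h2
  rw [this]
  exact Submodule.sum_mem _ fun i _ => Submodule.smul_mem _ _ (Submodule.subset_span ⟨i, rfl⟩)

end Gram

/-- A root: a vector of norm `-2` orthogonal to `K`. -/
def IsRoot (v : Fin 9 → ℤ) : Prop := dot v v = -2 ∧ dot v KK = 0

/-- A pair of simple roots of a root system of type `A₂`. -/
def IsEdge (a b : Fin 9 → ℤ) : Prop := IsRoot a ∧ IsRoot b ∧ dot a b = 1

lemma IsEdge.det_gram {a b : Fin 9 → ℤ} (h : IsEdge a b) : (gram ![a, b]).det = 3 := by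
  obtain ⟨⟨ha, -⟩, ⟨hb, -⟩, hab⟩ := h
  simp [gram, Matrix.det_fin_two, ha, hb, hab, dot_comm b a]

/-- Two pairs of vectors that are mutually orthogonal. -/
def OrthPairs (a b x y : Fin 9 → ℤ) : Prop :=
  dot a x = 0 ∧ dot a y = 0 ∧ dot b x = 0 ∧ dot b y = 0

lemma det_gram_KK : (gram ![KK]).det = 1 := by
  simp [gram, dot_KK_self]

/-- The root lattice `3A₂ + 2A₁` does not embed in `E₈`. -/
lemma not_threeA2_twoA1 {a b x y z w u v : Fin 9 → ℤ}
    (h1 : IsEdge a b) (h2 : IsEdge x y) (h3 : IsEdge z w) (hu : IsRoot u) (hv : IsRoot v)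
    (h12 : OrthPairs a b x y) (h13 : OrthPairs a b z w) (h14 : OrthPairs a b u v)
    (h23 : OrthPairs x y z w) (h24 : OrthPairs x y u v) (h34 : OrthPairs z w u v) :
    dot u v ≠ 0 := by
  intro huv
  have e : Fin 2 ⊕ Fin 2 ⊕ Fin 2 ⊕ Fin 2 ⊕ Fin 1 ≃ Fin 9 := Fintype.equivFinOfCardEq (by simp)
  obtain ⟨D, hD⟩ : ∃ D : ℤ, (gram (Sum.elim ![a, b] (Sum.elim ![x, y]
      (Sum.elim ![z, w] (Sum.elim ![u, v] ![KK]))))).det = D ^ 2 := ⟨_, det_gram_eq_sq _ e⟩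
  have huv4 : (gram ![u, v]).det = 4 := by
    simp [gram, Matrix.det_fin_two, hu.1, hv.1, huv, dot_comm v u]
  simp only [OrthPairs] at *
  rw [det_gram_sumElim, det_gram_sumElim, det_gram_sumElim, det_gram_sumElim, h1.det_gram,
    h2.det_gram, h3.det_gram, huv4, det_gram_KK] at hD
  · have h1 : D < 11 := by nlinarith
    have h2 : -11 < D := by nlinarith
    interval_cases D <;> omega
  · simp [Fin.forall_fin_two, hu.2, hv.2]
  · simp [Sum.forall, Fin.forall_fin_two, h34, h3.1.2, h3.2.1.2]
  · simp [Sum.forall, Fin.forall_fin_two, h23, h24, h2.1.2, h2.2.1.2]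
  · simp [Sum.forall, Fin.forall_fin_two, h12, h13, h14, h1.1.2, h1.2.1.2]

/-- The root lattice `2A₂ + A₃` does not embed in `E₈`. -/
lemma not_twoA2_A3 {a b x y z m p : Fin 9 → ℤ}
    (h1 : IsEdge a b) (h2 : IsEdge x y) (h3 : IsEdge z m) (h4 : IsEdge m p)
    (h12 : OrthPairs a b x y) (h13 : OrthPairs a b z m) (h14 : OrthPairs a b m p)
    (h23 : OrthPairs x y z m) (h24 : OrthPairs x y m p) : dot z p ≠ 0 := by
  intro hzp
  have hab := h1.det_gram
  have hxy := h2.det_gram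
  obtain ⟨⟨haa, haK⟩, ⟨hbb, hbK⟩, hab1⟩ := h1
  obtain ⟨⟨hxx, hxK⟩, ⟨hyy, hyK⟩, hxy1⟩ := h2
  obtain ⟨⟨hzz, hzK⟩, ⟨hmm, hmK⟩, hzm⟩ := h3
  obtain ⟨-, ⟨hpp, hpK⟩, hmp⟩ := h4
  obtain ⟨hax, hay, hbx, hby⟩ := h12
  obtain ⟨haz, ham, hbz, hbm⟩ := h13
  obtain ⟨-, hap, -, hbp⟩ := h14
  obtain ⟨hxz, hxm, hyz, hym⟩ := h23
  obtain ⟨-, hxp, -, hyp⟩ := h24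
  -- Complete the seven roots and `K` to a basis of `ℤ⁹` modulo 2 by a vector `w` orthogonal to
  -- both copies of `A₂` and to `K`.
  obtain ⟨w₀, hw₀⟩ := exists_not_combination_mod_two ![a, b, x, y, z, m, p, KK] (by simp)
  obtain ⟨α, hα⟩ : ∃ α, α = 2 * dot w₀ a + dot w₀ b := ⟨_, rfl⟩
  obtain ⟨β, hβ⟩ : ∃ β, β = dot w₀ a + 2 * dot w₀ b := ⟨_, rfl⟩
  obtain ⟨ξ, hξ⟩ : ∃ ξ, ξ = 2 * dot w₀ x + dot w₀ y := ⟨_, rfl⟩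
  obtain ⟨η, hη⟩ : ∃ η, η = dot w₀ x + 2 * dot w₀ y := ⟨_, rfl⟩
  obtain ⟨κ, hκ⟩ : ∃ κ, κ = -3 * dot w₀ KK := ⟨_, rfl⟩
  obtain ⟨w, hw⟩ : ∃ w, w = (3 : ℤ) • w₀ + α • a + β • b + ξ • x + η • y + κ • KK := ⟨_, rfl⟩
  have hba := dot_comm b a
  have hyx := dot_comm y x
  have hxa := dot_comm x a
  have hya := dot_comm y a
  have hxb := dot_comm x b
  have hyb := dot_comm y b
  have hKa := dot_comm KK a
  have hKb := dot_comm KK b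
  have hKx := dot_comm KK x
  have hKy := dot_comm KK y
  have hwa : dot w a = 0 := by
    simp only [hw, dot_add_left, dot_smul_left]; rw [hba, hxa, hya, hKa]; simp only [*]; ring
  have hwb : dot w b = 0 := by
    simp only [hw, dot_add_left, dot_smul_left]; rw [hxb, hyb, hKb]; simp only [*]; ring
  have hwx : dot w x = 0 := by
    simp only [hw, dot_add_left, dot_smul_left]; rw [hyx, hKx]; simp only [*]; ring
  have hwy : dot w y = 0 := by
    simp only [hw, dot_add_left, dot_smul_left]; rw [hKy]; simp only [*]; ring
  have hwK : dot w KK = 0 := by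
    simp only [hw, dot_add_left, dot_smul_left, dot_KK_self]; simp only [*]; ring
  have e : Fin 2 ⊕ Fin 2 ⊕ Fin 4 ⊕ Fin 1 ≃ Fin 9 := Fintype.equivFinOfCardEq (by simp)
  obtain ⟨f, hf⟩ : ∃ f, f = Sum.elim ![a, b] (Sum.elim ![x, y]
    (Sum.elim ![z, m, p, w] ![KK])) := ⟨_, rfl⟩
  have hD := det_gram_eq_sq f e
  have hodd : ¬ Even (coordMatrix f e).det := by
    intro heven
    obtain ⟨c, ⟨i, hi⟩, q, hq⟩ := exists_odd_combination_of_even_det f e heven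
    simp only [hf, Fintype.sum_sum_type, Fin.sum_univ_two, Fin.sum_univ_four, Fin.sum_univ_one,
      Sum.elim_inl, Sum.elim_inr, Matrix.cons_val] at hq
    rcases Int.even_or_odd (c (.inr (.inr (.inl 3)))) with ⟨k, hk⟩ | ⟨k, hk⟩
    swap
    · refine hw₀ ![-c (.inl 0) - α, -c (.inl 1) - β, -c (.inr (.inl 0)) - ξ, -c (.inr (.inl 1)) - η,
        -c (.inr (.inr (.inl 0))), -c (.inr (.inr (.inl 1))), -c (.inr (.inr (.inl 2))),
        -c (.inr (.inr (.inr 0))) - κ] (q - k • w - w₀) ?_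
      rw [hk] at hq
      simp only [Fin.sum_univ_eight, Matrix.cons_val]
      linear_combination (exp := 1) hq - hw
    have pair := fun v => congrArg (dot · v) hq
    simp only [dot_add_left, dot_smul_left, hk, add_mul] at pair
    have pK := pair KK
    have pa := pair a
    have pb := pair b
    have px := pair x
    have py := pair y
    have pz := pair z
    have pm := pair m
    simp only [haK, hbK, hxK, hyK, hzK, hmK, hpK, hwK, dot_KK_self] at pK
    simp only [haa, hba, hab1, hxa, hya, hKa, hwa, dot_comm z a, dot_comm m a, dot_comm p a,
      hax, hay, haz, ham, hap, haK] at pa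
    simp only [hbb, hab1, hxb, hyb, hKb, hwb, dot_comm z b, dot_comm m b, dot_comm p b,
      hbx, hby, hbz, hbm, hbp, hbK] at pb
    simp only [hax, hbx, hxx, hyx, hxy1, hKx, hxK, hwx, dot_comm z x, dot_comm m x, dot_comm p x,
      hxz, hxm, hxp] at px
    simp only [hay, hby, hxy1, hyy, hKy, hyK, hwy, dot_comm z y, dot_comm m y, dot_comm p y,
      hyz, hym, hyp] at py
    simp only [haz, hbz, hxz, hyz, hzz, dot_comm m z, hzm, dot_comm p z, hzp, dot_comm KK z, hzK]
      at pz
    simp only [ham, hbm, hxm, hym, hzm, hmm, dot_comm p m, hmp, dot_comm KK m, hmK] at pm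
    obtain ⟨N, hN⟩ : Even (c (.inr (.inr (.inr 0)))) := by rw [even_iff_two_dvd]; omega
    obtain ⟨A, hA⟩ : Even (c (.inl 0)) := by rw [even_iff_two_dvd]; omega
    obtain ⟨B, hB⟩ : Even (c (.inl 1)) := by rw [even_iff_two_dvd]; omega
    obtain ⟨X, hX⟩ : Even (c (.inr (.inl 0))) := by rw [even_iff_two_dvd]; omega
    obtain ⟨Y, hY⟩ : Even (c (.inr (.inl 1))) := by rw [even_iff_two_dvd]; omega
    obtain ⟨M, hM⟩ : Even (c (.inr (.inr (.inl 1)))) := by rw [even_iff_two_dvd]; omega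
    have hcz : c (.inr (.inr (.inl 0))) % 2 = 1 := by
      rw [Int.odd_iff] at hi
      rcases i with i | i | i | i <;> fin_cases i <;> simp at hi <;> omega
    obtain ⟨Z, hZ⟩ : Odd (c (.inr (.inr (.inl 0)))) := by rw [Int.odd_iff]; omega
    obtain ⟨P, hP⟩ : Odd (c (.inr (.inr (.inl 2)))) := by rw [Int.odd_iff]; omega
    obtain ⟨r, hr⟩ : ∃ r : Fin 9 → ℤ, z + p = (2 : ℤ) • r := by
      refine ⟨q - A • a - B • b - X • x - Y • y - Z • z - M • m - P • p - k • w - N • KK, ?_⟩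
      rw [hN, hA, hB, hX, hY, hM, hZ, hP, hk] at hq
      linear_combination (exp := 1) hq
    have hrK : dot r KK = 0 := by
      have := congrArg (dot · KK) hr
      simp only [dot_add_left, dot_smul_left, hzK, hpK] at this
      omega
    have hrr : 2 * (2 * dot r r) = -4 := by
      rw [← dot_smul_right, ← dot_smul_left, ← hr]
      simp only [dot_add_left, dot_add_right, hzz, hpp, hzp, dot_comm p z]
      norm_num
    obtain ⟨t, ht⟩ := even_dot_self hrK
    omega
  have hd4 : (gram ![z, m, p, w]).det = -4 * dot w w - (3 * dot w z ^ 2 + 4 * dot w m ^ 2 +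
      3 * dot w p ^ 2 + 4 * dot w z * dot w m + 4 * dot w m * dot w p + 2 * dot w z * dot w p) := by
    simp [gram, Matrix.det_succ_row_zero, Fin.sum_univ_succ, Fin.succAbove, hzz, hmm, hpp, hzm,
      hmp, hzp,
      dot_comm m z, dot_comm p m, dot_comm p z, dot_comm z w, dot_comm m w, dot_comm p w]
    ring
  rw [hf, det_gram_sumElim, det_gram_sumElim, det_gram_sumElim, hab, hxy, hd4, det_gram_KK, ← hf]
    at hD
  · have hodd' := Int.not_even_iff_odd.mp hodd
    obtain ⟨n, hn⟩ := even_dot_self hwK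
    generalize (coordMatrix f e).det = D at hD hodd'
    generalize dot w z = γ at hD
    generalize dot w m = δ at hD
    generalize dot w p = ε at hD
    have hD8 := congrArg (Int.cast : ℤ → ZMod 8) hD
    have hsq : (D : ZMod 8) ^ 2 = 1 := by
      have := (ZMod.intCast_eq_intCast_iff_dvd_sub 1 (D ^ 2) 8).mpr
        (Int.eight_dvd_sq_sub_one_of_odd hodd')
      push_cast at this
      exact this.symm
    have key : ∀ γ δ ε n : ZMod 8, 3 * (3 * ((-4 * (n + n) - (3 * γ ^ 2 + 4 * δ ^ 2 + 3 * ε ^ 2 +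
        4 * γ * δ + 4 * δ * ε + 2 * γ * ε)) * 1)) ≠ 1 := by
      intro γ δ ε n
      have h8 : (8 : ZMod 8) = 0 := rfl
      have : ∀ γ δ ε : ZMod 8, 3 * (3 * ((- (3 * γ ^ 2 + 4 * δ ^ 2 + 3 * ε ^ 2 +
        4 * γ * δ + 4 * δ * ε + 2 * γ * ε)) * 1)) ≠ 1 := by decide
      intro h
      exact this γ δ ε (by linear_combination h + 9 * n * h8)
    rw [hn] at hD8
    push_cast at hD8
    exact key _ _ _ _ (hD8.trans hsq)
  · simp [Fin.forall_fin_succ, hzK, hmK, hpK, hwK]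
  · simp [Sum.forall, Fin.forall_fin_succ, hxz, hxm, hxp, hxK, hyz, hym, hyp, hyK,
      dot_comm x w, dot_comm y w, hwx, hwy]
  · simp [Sum.forall, Fin.forall_fin_succ, hax, hay, hbx, hby, haz, ham, hap, haK, hbz, hbm, hbp,
      hbK, dot_comm a w, dot_comm b w, hwa, hwb]

/-! ### Sets of roots with nonnegative products -/

/-- A finite set of roots whose distinct members have product 0 or 1. -/
def IsObtuse (S : Finset (Fin 9 → ℤ)) : Prop :=
  (∀ s ∈ S, IsRoot s) ∧ ∀ s ∈ S, ∀ t ∈ S, s ≠ t → dot s t = 0 ∨ dot s t = 1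

/-- A nonempty finite set admitting a linear relation with positive coefficients. -/
def PosDep (T : Finset (Fin 9 → ℤ)) : Prop :=
  T.Nonempty ∧ ∃ c : (Fin 9 → ℤ) → ℤ, (∀ s ∈ T, 0 < c s) ∧ ∑ s ∈ T, c s • s = 0

lemma dot_sum_smul_KK {T : Finset (Fin 9 → ℤ)} (hT : ∀ s ∈ T, IsRoot s) (c : (Fin 9 → ℤ) → ℤ) :
    dot (∑ s ∈ T, c s • s) KK = 0 := by
  rw [dot_sum_left]
  exact Finset.sum_eq_zero fun s hs => by rw [dot_smul_left, (hT s hs).2, mul_zero]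

section Obtuse

variable {S T T₁ T₂ T₃ : Finset (Fin 9 → ℤ)}

lemma IsObtuse.mono (hS : IsObtuse S) (h : T ⊆ S) : IsObtuse T :=
  ⟨fun s hs => hS.1 s (h hs), fun s hs t ht => hS.2 s (h hs) t (h ht)⟩

lemma IsObtuse.exists_posDep (hS : IsObtuse S) (hcard : 9 ≤ S.card) : ∃ T ⊆ S, PosDep T := by
  have hKS : KK ∉ S := fun h => by
    have := (hS.1 _ h).2
    rw [dot_KK_self] at this
    omega
  obtain ⟨c, hc, r, hr, hr0⟩ :=
    Module.exists_nontrivial_relation_of_finrank_lt_card (R := ℤ) (t := insert KK S)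
      (by rw [Finset.card_insert_of_notMem hKS, Module.finrank_fin_fun]; omega)
  rw [Finset.sum_insert hKS] at hc
  have hcK : c KK = 0 := by
    have := congrArg (dot · KK) hc
    simpa [-zsmul_eq_mul, dot_add_left, dot_smul_left, dot_KK_self, dot_sum_smul_KK hS.1,
      dot_zero_left] using this
  rw [hcK, zero_smul, zero_add] at hc
  have hrS : r ∈ S := by
    rcases Finset.mem_insert.mp hr with rfl | h
    · exact absurd hcK hr0
    · exact h
  set P := S.filter fun s => 0 < c s with hP
  set N := S.filter fun s => c s < 0 with hN
  have hsplit : ∑ s ∈ P, c s • s = ∑ s ∈ N, (-c s) • s := by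
    rw [← sub_eq_zero, ← hc, hP, hN, Finset.sum_filter, Finset.sum_filter,
      ← Finset.sum_sub_distrib]
    refine Finset.sum_congr rfl fun s _ => ?_
    rcases lt_trichotomy (c s) 0 with h | h | h
    · simp [h, h.not_gt]
    · simp [h]
    · simp [h, h.not_gt]
  have hzero : ∑ s ∈ P, c s • s = 0 := by
    refine eq_zero_of_dot_self_nonneg
      (dot_sum_smul_KK (fun s hs => hS.1 s (Finset.mem_filter.mp hs).1) c) ?_
    conv_rhs => arg 2; rw [hsplit]
    rw [dot_sum_left]
    refine Finset.sum_nonneg fun s hs => ?_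
    rw [dot_sum_right]
    refine Finset.sum_nonneg fun t ht => ?_
    obtain ⟨hs, hcs⟩ := Finset.mem_filter.mp hs
    obtain ⟨ht, hct⟩ := Finset.mem_filter.mp ht
    have hd : 0 ≤ dot s t := by
      rcases hS.2 s hs t ht (by rintro rfl; omega) with h | h <;> omega
    rw [dot_smul_left, dot_smul_right]
    exact mul_nonneg hcs.le (mul_nonneg (by omega) hd)
  rcases lt_or_gt_of_ne hr0 with h | h
  · exact ⟨N, Finset.filter_subset _ _, ⟨r, Finset.mem_filter.mpr ⟨hrS, h⟩⟩, fun s => -c s,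
      fun s hs => neg_pos.mpr (Finset.mem_filter.mp hs).2, hsplit.symm.trans hzero⟩
  · exact ⟨P, Finset.filter_subset _ _, ⟨r, Finset.mem_filter.mpr ⟨hrS, h⟩⟩, c,
      fun s hs => (Finset.mem_filter.mp hs).2, hzero⟩

lemma IsObtuse.exists_minimal_posDep (hS : IsObtuse S) (hcard : 9 ≤ S.card) :
    ∃ T ⊆ S, Minimal PosDep T := by
  obtain ⟨T, hTS, hT⟩ := hS.exists_posDep hcard
  obtain ⟨T', hT', hmin⟩ := exists_minimal_le_of_wellFoundedLT PosDep T hT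
  exact ⟨T', hT'.trans hTS, hmin⟩

lemma IsObtuse.dot_eq_zero (hS : IsObtuse S) (hTS : T ⊆ S) (hT : PosDep T)
    {s t : Fin 9 → ℤ} (hs : s ∈ S) (hsT : s ∉ T) (ht : t ∈ T) : dot s t = 0 := by
  obtain ⟨-, c, hc, hsum⟩ := hT
  have h0 : ∑ t ∈ T, c t * dot s t = 0 := by
    have := congrArg (dot s) hsum
    simpa [-zsmul_eq_mul, dot_sum_right, dot_smul_right, dot_comm s 0, dot_zero_left] using this
  have hnn : ∀ t ∈ T, 0 ≤ c t * dot s t := fun t ht => by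
    refine mul_nonneg (hc t ht).le ?_
    rcases hS.2 s hs t (hTS ht) (by rintro rfl; exact hsT ht) with h | h <;> omega
  have := (Finset.sum_eq_zero_iff_of_nonneg hnn).mp h0 t ht
  exact (mul_eq_zero.mp this).resolve_left (hc t ht).ne'

lemma IsObtuse.disjoint_of_minimal (hS : IsObtuse S) (h₁S : T₁ ⊆ S) (h₂S : T₂ ⊆ S)
    (h₁ : Minimal PosDep T₁) (h₂ : Minimal PosDep T₂) (hne : T₁ ≠ T₂) : Disjoint T₁ T₂ := by
  rw [Finset.disjoint_iff_inter_eq_empty]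
  by_contra hemp
  obtain ⟨-, c, hc, hsum⟩ := h₂.prop
  rw [Finset.inter_comm] at hemp
  have hsplit := Finset.sum_inter_add_sum_sdiff T₂ T₁ fun s => c s • s
  rw [hsum] at hsplit
  have hself : dot (∑ s ∈ T₂ ∩ T₁, c s • s) (∑ s ∈ T₂ ∩ T₁, c s • s) = 0 := by
    conv_lhs => arg 1; rw [eq_neg_of_add_eq_zero_left hsplit]
    rw [dot_neg_left, dot_sum_left, neg_eq_zero]
    refine Finset.sum_eq_zero fun s hs => ?_
    rw [dot_sum_right]
    refine Finset.sum_eq_zero fun t ht => ?_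
    obtain ⟨hs, hs'⟩ := Finset.mem_sdiff.mp hs
    rw [dot_smul_left, dot_smul_right,
      hS.dot_eq_zero h₁S h₁.prop (h₂S hs) hs' (Finset.mem_inter.mp ht).2]
    ring
  have hzero := eq_zero_of_dot_self_nonneg
    (dot_sum_smul_KK (fun s hs => hS.1 s (h₂S (Finset.mem_inter.mp hs).1)) c) hself.ge
  have hdep : PosDep (T₂ ∩ T₁) := ⟨Finset.nonempty_iff_ne_empty.mpr hemp, c,
    fun s hs => hc s (Finset.mem_inter.mp hs).1, hzero⟩
  exact hne ((h₁.eq_of_le hdep Finset.inter_subset_right).symm.trans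
    (h₂.eq_of_le hdep Finset.inter_subset_left))

lemma IsObtuse.isEdge (hS : IsObtuse S) {s t : Fin 9 → ℤ} (hs : s ∈ S) (ht : t ∈ S)
    (hst : dot s t = 1) : IsEdge s t := ⟨hS.1 s hs, hS.1 t ht, hst⟩

/-- A positive relation, paired with a member of its support. -/
lemma sum_mul_dot_eq_zero {c : (Fin 9 → ℤ) → ℤ} (hsum : ∑ s ∈ T, c s • s = 0) (t : Fin 9 → ℤ) :
    ∑ s ∈ T, c s * dot s t = 0 := by
  have := congrArg (dot · t) hsum
  simpa [-zsmul_eq_mul, dot_sum_left, dot_smul_left, dot_zero_left] using this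

lemma IsObtuse.exists_edge (hT : IsObtuse T) (hdep : PosDep T) :
    ∃ s ∈ T, ∃ t ∈ T, dot s t = 1 := by
  by_contra! h
  obtain ⟨⟨s, hs⟩, c, hc, hsum⟩ := hdep
  have h0 := sum_mul_dot_eq_zero hsum s
  rw [Finset.sum_eq_single_of_mem s hs, (hT.1 s hs).1] at h0
  · have := hc s hs
    omega
  · intro t ht hts
    rw [(hT.2 t ht s hs hts).resolve_right (h t ht s hs), mul_zero]

/-- A minimal positively dependent set of roots is a triangle or contains a path of length 2. -/
lemma IsObtuse.card_eq_three_or_exists_path (hT : IsObtuse T) (hmin : Minimal PosDep T) :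
    T.card = 3 ∨ ∃ s ∈ T, ∃ t ∈ T, ∃ u ∈ T, dot s t = 1 ∧ dot t u = 1 ∧ dot s u = 0 := by
  obtain ⟨s, hs, t, ht, hst⟩ := hT.exists_edge hmin.prop
  have hne : ∀ {x y}, x ∈ T → dot x y = 1 → x ≠ y := by
    rintro x _ hx hxy rfl
    have := (hT.1 x hx).1
    omega
  have hts : dot t s = 1 := (dot_comm t s).trans hst
  obtain ⟨u, hu, hus, hut, hadj⟩ : ∃ u ∈ T, u ≠ s ∧ u ≠ t ∧ (dot u s = 1 ∨ dot u t = 1) := by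
    by_contra! h
    obtain ⟨-, c, hc, hsum⟩ := hmin.prop
    have pair : ∀ x y, x ∈ T → y ∈ T → dot x y = 1 →
        (∀ u ∈ T, u ≠ x → u ≠ y → dot u y ≠ 1) → c x = 2 * c y := by
      intro x y hx hy hxy hno
      have h0 := sum_mul_dot_eq_zero hsum y
      rw [Finset.sum_eq_add_of_mem x y hx hy (hne hx hxy), hxy, (hT.1 y hy).1] at h0
      · omega
      · rintro u hu ⟨hux, huy⟩
        rw [(hT.2 u hu y hy huy).resolve_right (hno u hu hux huy), mul_zero]
    have e1 := pair s t hs ht hst fun u hu h1 h2 => (h u hu h1 h2).2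
    have e2 := pair t s ht hs hts fun u hu h1 h2 => (h u hu h2 h1).1
    have := hc s hs
    omega
  by_cases hboth : dot u s = 1 ∧ dot u t = 1
  · left
    have hdep : PosDep {s, t, u} := by
      refine ⟨⟨s, by simp⟩, fun _ => 1, fun _ _ => one_pos, ?_⟩
      rw [Finset.sum_insert (by simp [hne hs hst, hus.symm]), Finset.sum_pair hut.symm]
      simp only [one_smul]
      refine eq_zero_of_dot_self_nonneg ?_ ?_
      · simp [dot_add_left, (hT.1 s hs).2, (hT.1 t ht).2, (hT.1 u hu).2]
      · simp [dot_add_left, dot_add_right, (hT.1 s hs).1, (hT.1 t ht).1, (hT.1 u hu).1, hst, hts,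
          hboth, dot_comm s u, dot_comm t u]
    rw [← hmin.eq_of_le hdep (by simp [Finset.insert_subset_iff, hs, ht, hu])]
    exact Finset.card_eq_three.mpr ⟨s, t, u, hne hs hst, hus.symm, hut.symm, rfl⟩
  · right
    rcases hadj with h | h
    · exact ⟨u, hu, s, hs, t, ht, h, hst,
        (hT.2 u hu t ht hut).resolve_right fun h' => hboth ⟨h, h'⟩⟩
    · exact ⟨u, hu, t, ht, s, hs, h, hts,
        (hT.2 u hu s hs hus).resolve_right fun h' => hboth ⟨h', h⟩⟩

lemma IsObtuse.orthPairs (hS : IsObtuse S) (hTS : T ⊆ S) (hT : PosDep T) {a b x y : Fin 9 → ℤ}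
    (ha : a ∈ T) (hb : b ∈ T) (hx : x ∈ S \ T) (hy : y ∈ S \ T) : OrthPairs a b x y := by
  rw [Finset.mem_sdiff] at hx hy
  refine ⟨?_, ?_, ?_, ?_⟩ <;> rw [dot_comm]
  · exact hS.dot_eq_zero hTS hT hx.1 hx.2 ha
  · exact hS.dot_eq_zero hTS hT hy.1 hy.2 ha
  · exact hS.dot_eq_zero hTS hT hx.1 hx.2 hb
  · exact hS.dot_eq_zero hTS hT hy.1 hy.2 hb

lemma IsObtuse.card_eq_three (hS : IsObtuse S) (h₁S : T₁ ⊆ S) (h₂S : T₂ ⊆ S) (h₃S : T₃ ⊆ S)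
    (h₁ : PosDep T₁) (h₂ : PosDep T₂) (h₃ : Minimal PosDep T₃)
    (h₁₂ : Disjoint T₁ T₂) (h₁₃ : Disjoint T₁ T₃) (h₂₃ : Disjoint T₂ T₃) : T₃.card = 3 := by
  refine ((hS.mono h₃S).card_eq_three_or_exists_path h₃).resolve_right ?_
  rintro ⟨z, hz, m, hm, p, hp, hzm, hmp, hzp⟩
  obtain ⟨a, ha, b, hb, hab⟩ := (hS.mono h₁S).exists_edge h₁
  obtain ⟨x, hx, y, hy, hxy⟩ := (hS.mono h₂S).exists_edge h₂
  have m₁₂ : ∀ {v}, v ∈ T₂ → v ∈ S \ T₁ := fun hv =>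
    Finset.mem_sdiff.mpr ⟨h₂S hv, Finset.disjoint_right.mp h₁₂ hv⟩
  have m₁₃ : ∀ {v}, v ∈ T₃ → v ∈ S \ T₁ := fun hv =>
    Finset.mem_sdiff.mpr ⟨h₃S hv, Finset.disjoint_right.mp h₁₃ hv⟩
  have m₂₃ : ∀ {v}, v ∈ T₃ → v ∈ S \ T₂ := fun hv =>
    Finset.mem_sdiff.mpr ⟨h₃S hv, Finset.disjoint_right.mp h₂₃ hv⟩
  exact not_twoA2_A3 (hS.isEdge (h₁S ha) (h₁S hb) hab) (hS.isEdge (h₂S hx) (h₂S hy) hxy)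
    (hS.isEdge (h₃S hz) (h₃S hm) hzm) (hS.isEdge (h₃S hm) (h₃S hp) hmp)
    (hS.orthPairs h₁S h₁ ha hb (m₁₂ hx) (m₁₂ hy)) (hS.orthPairs h₁S h₁ ha hb (m₁₃ hz) (m₁₃ hm))
    (hS.orthPairs h₁S h₁ ha hb (m₁₃ hm) (m₁₃ hp)) (hS.orthPairs h₂S h₂ hx hy (m₂₃ hz) (m₂₃ hm))
    (hS.orthPairs h₂S h₂ hx hy (m₂₃ hm) (m₂₃ hp)) hzp

/-- A set of eleven roots with pairwise products 0 or 1 can be enlarged. -/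
lemma IsObtuse.exists_extension (hS : IsObtuse S) (hcard : S.card = 11) :
    ∃ w ∉ S, IsRoot w ∧ ∀ s ∈ S, dot w s = 0 ∨ dot w s = 1 := by
  obtain ⟨T₁, h₁S, h₁⟩ := hS.exists_minimal_posDep (by omega)
  obtain ⟨s₁, hs₁⟩ := h₁.prop.1
  have hcard₁ := Finset.card_erase_of_mem (h₁S hs₁)
  obtain ⟨T₂, h₂S', h₂⟩ := (hS.mono (Finset.erase_subset s₁ S)).exists_minimal_posDep (by omega)
  have h₂S := h₂S'.trans (Finset.erase_subset _ _)
  have hd₁₂ := hS.disjoint_of_minimal h₁S h₂S h₁ h₂ fun h =>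
    Finset.notMem_erase s₁ S (h₂S' (h ▸ hs₁))
  obtain ⟨s₂, hs₂⟩ := h₂.prop.1
  have hcard₂ := Finset.card_erase_of_mem (h₂S' hs₂)
  obtain ⟨T₃, h₃S', h₃⟩ := (hS.mono ((Finset.erase_subset s₂ _).trans
    (Finset.erase_subset s₁ S))).exists_minimal_posDep (by omega)
  have h₃S := h₃S'.trans ((Finset.erase_subset s₂ _).trans (Finset.erase_subset s₁ S))
  have hd₁₃ := hS.disjoint_of_minimal h₁S h₃S h₁ h₃ fun h =>
    Finset.notMem_erase s₁ S (Finset.erase_subset _ _ (h₃S' (h ▸ hs₁)))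
  have hd₂₃ := hS.disjoint_of_minimal h₂S h₃S h₂ h₃ fun h =>
    Finset.notMem_erase s₂ _ (h₃S' (h ▸ hs₂))
  have c₃ := hS.card_eq_three h₁S h₂S h₃S h₁.prop h₂.prop h₃ hd₁₂ hd₁₃ hd₂₃
  have c₂ := hS.card_eq_three h₁S h₃S h₂S h₁.prop h₃.prop h₂ hd₁₃ hd₁₂ hd₂₃.symm
  have c₁ := hS.card_eq_three h₂S h₃S h₁S h₂.prop h₃.prop h₁ hd₂₃ hd₁₂.symm hd₁₃.symm
  have hU : (S \ (T₁ ∪ T₂ ∪ T₃)).card = 2 := by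
    rw [Finset.card_sdiff_of_subset (Finset.union_subset (Finset.union_subset h₁S h₂S) h₃S),
      Finset.card_union_of_disjoint (Finset.disjoint_union_left.mpr ⟨hd₁₃, hd₂₃⟩),
      Finset.card_union_of_disjoint hd₁₂]
    omega
  obtain ⟨u, v, huv, hUeq⟩ := Finset.card_eq_two.mp hU
  have hmem : ∀ r, (r ∈ S ∧ r ∉ T₁ ∧ r ∉ T₂ ∧ r ∉ T₃) ↔ r = u ∨ r = v := by
    intro r
    have := Finset.ext_iff.mp hUeq r
    simp only [Finset.mem_sdiff, Finset.mem_union, Finset.mem_insert, Finset.mem_singleton] at this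
    rw [← this]
    tauto
  obtain ⟨huS, hu₁, hu₂, hu₃⟩ := (hmem u).mpr (.inl rfl)
  obtain ⟨hvS, hv₁, hv₂, hv₃⟩ := (hmem v).mpr (.inr rfl)
  have hdot : dot u v = 1 := by
    refine (hS.2 u huS v hvS huv).resolve_left ?_
    obtain ⟨a, ha, b, hb, hab⟩ := (hS.mono h₁S).exists_edge h₁.prop
    obtain ⟨x, hx, y, hy, hxy⟩ := (hS.mono h₂S).exists_edge h₂.prop
    obtain ⟨z, hz, w, hw, hzw⟩ := (hS.mono h₃S).exists_edge h₃.prop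
    have m₁₂ : ∀ {v}, v ∈ T₂ → v ∈ S \ T₁ := fun hv =>
      Finset.mem_sdiff.mpr ⟨h₂S hv, Finset.disjoint_right.mp hd₁₂ hv⟩
    have m₁₃ : ∀ {v}, v ∈ T₃ → v ∈ S \ T₁ := fun hv =>
      Finset.mem_sdiff.mpr ⟨h₃S hv, Finset.disjoint_right.mp hd₁₃ hv⟩
    have m₂₃ : ∀ {v}, v ∈ T₃ → v ∈ S \ T₂ := fun hv =>
      Finset.mem_sdiff.mpr ⟨h₃S hv, Finset.disjoint_right.mp hd₂₃ hv⟩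
    exact not_threeA2_twoA1 (hS.isEdge (h₁S ha) (h₁S hb) hab) (hS.isEdge (h₂S hx) (h₂S hy) hxy)
      (hS.isEdge (h₃S hz) (h₃S hw) hzw) (hS.1 u huS) (hS.1 v hvS)
      (hS.orthPairs h₁S h₁.prop ha hb (m₁₂ hx) (m₁₂ hy))
      (hS.orthPairs h₁S h₁.prop ha hb (m₁₃ hz) (m₁₃ hw))
      (hS.orthPairs h₁S h₁.prop ha hb (Finset.mem_sdiff.mpr ⟨huS, hu₁⟩)
        (Finset.mem_sdiff.mpr ⟨hvS, hv₁⟩))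
      (hS.orthPairs h₂S h₂.prop hx hy (m₂₃ hz) (m₂₃ hw))
      (hS.orthPairs h₂S h₂.prop hx hy (Finset.mem_sdiff.mpr ⟨huS, hu₂⟩)
        (Finset.mem_sdiff.mpr ⟨hvS, hv₂⟩))
      (hS.orthPairs h₃S h₃.prop hz hw (Finset.mem_sdiff.mpr ⟨huS, hu₃⟩)
        (Finset.mem_sdiff.mpr ⟨hvS, hv₃⟩))
  obtain ⟨huu, huK⟩ := hS.1 u huS
  obtain ⟨hvv, hvK⟩ := hS.1 v hvS
  have hvu : dot v u = 1 := (dot_comm v u).trans hdot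
  have hw : ∀ s, dot (-u + -v) s = -dot u s - dot v s := fun s => by
    rw [dot_add_left, dot_neg_left, dot_neg_left, sub_eq_add_neg]
  have hcase : ∀ s ∈ S, dot (-u + -v) s = 0 ∨ dot (-u + -v) s = 1 ∧ (s = u ∨ s = v) := by
    intro s hs
    by_cases hsU : s ∉ T₁ ∧ s ∉ T₂ ∧ s ∉ T₃
    · right
      have hsuv := (hmem s).mp ⟨hs, hsU⟩
      refine ⟨?_, hsuv⟩
      rw [hw]
      rcases hsuv with rfl | rfl <;> omega
    · left
      have hz : dot u s = 0 ∧ dot v s = 0 := by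
        by_cases m₁ : s ∈ T₁
        · exact ⟨hS.dot_eq_zero h₁S h₁.prop huS hu₁ m₁, hS.dot_eq_zero h₁S h₁.prop hvS hv₁ m₁⟩
        by_cases m₂ : s ∈ T₂
        · exact ⟨hS.dot_eq_zero h₂S h₂.prop huS hu₂ m₂, hS.dot_eq_zero h₂S h₂.prop hvS hv₂ m₂⟩
        · have m₃ : s ∈ T₃ := by tauto
          exact ⟨hS.dot_eq_zero h₃S h₃.prop huS hu₃ m₃, hS.dot_eq_zero h₃S h₃.prop hvS hv₃ m₃⟩
      rw [hw, hz.1, hz.2]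
      rfl
  have hroot : IsRoot (-u + -v) := by
    constructor
    · simp only [hw, dot_add_right, dot_neg_right, huu, hvv, hdot, hvu]
      norm_num
    · rw [hw, huK, hvK]
      rfl
  refine ⟨-u + -v, fun hmemS => ?_, hroot, fun s hs => (hcase s hs).imp_right And.left⟩
  have := hroot.1
  rcases hcase _ hmemS with h | ⟨h, -⟩ <;> omega

end Obtuse

lemma isRoot_add_KK {d : Fin 9 → ℤ} (hd : IsExceptional d) : IsRoot (d + KK) := by
  obtain ⟨h1, h2⟩ := hd
  have := dot_comm KK d
  have := dot_KK_self
  constructor <;> simp only [dot_add_left, dot_add_right] <;> omega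

lemma isExceptional_sub_KK {w : Fin 9 → ℤ} (hw : IsRoot w) : IsExceptional (w + -KK) := by
  obtain ⟨h1, h2⟩ := hw
  have := dot_comm KK w
  have := dot_KK_self
  constructor <;> simp only [dot_add_left, dot_add_right, dot_neg_left, dot_neg_right] <;> omega

/-- Every set of 11 exceptional vectors with pairwise products in {1, 2} is contained in a set
of 12 exceptional vectors with pairwise products in {1, 2}: no maximal such cliques of size 11. -/
theorem stmt_9 (S : Finset (Fin 9 → ℤ)) (hexc : ∀ d ∈ S, IsExceptional d)
    (hw : ∀ d ∈ S, ∀ e ∈ S, d ≠ e → dot d e = 1 ∨ dot d e = 2) (hcard : S.card = 11) :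
    ∃ S' : Finset (Fin 9 → ℤ), S ⊆ S' ∧ (∀ d ∈ S', IsExceptional d) ∧
      (∀ d ∈ S', ∀ e ∈ S', d ≠ e → dot d e = 1 ∨ dot d e = 2) ∧ S'.card = 12 := by
  have hshift : ∀ d e, IsExceptional d → IsExceptional e →
      dot (d + KK) (e + KK) = dot d e - 1 := by
    intro d e hd he
    have h1 := hd.2
    have h2 := he.2
    have h3 := dot_comm KK e
    have h4 := dot_KK_self
    simp only [dot_add_left, dot_add_right]
    omega
  have hobt : IsObtuse (S.map (addRightEmbedding KK)) := by
    constructor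
    · simp only [Finset.mem_map, addRightEmbedding_apply]
      rintro _ ⟨d, hd, rfl⟩
      exact isRoot_add_KK (hexc d hd)
    · simp only [Finset.mem_map, addRightEmbedding_apply]
      rintro _ ⟨d, hd, rfl⟩ _ ⟨e, he, rfl⟩ hne
      have := hw d hd e he fun h => hne (h ▸ rfl)
      rw [hshift d e (hexc d hd) (hexc e he)]
      omega
  obtain ⟨w, hwS, hwr, hwdot⟩ := hobt.exists_extension (by rw [Finset.card_map, hcard])
  have hex := isExceptional_sub_KK hwr
  have hnot : w + -KK ∉ S := fun h =>
    hwS (Finset.mem_map.mpr ⟨_, h, by simp⟩)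
  have hnew : ∀ d ∈ S, dot (w + -KK) d = 1 ∨ dot (w + -KK) d = 2 := by
    intro d hd
    have h1 := hwdot (d + KK) (Finset.mem_map.mpr ⟨d, hd, rfl⟩)
    have h2 := hshift _ d hex (hexc d hd)
    rw [neg_add_cancel_right] at h2
    omega
  refine ⟨insert (w + -KK) S, Finset.subset_insert _ _, ?_, ?_, ?_⟩
  · intro d hd
    rcases Finset.mem_insert.mp hd with rfl | hd
    · exact hex
    · exact hexc d hd
  · intro d hd e he hne
    rcases Finset.mem_insert.mp hd with rfl | hd <;> rcases Finset.mem_insert.mp he with rfl | he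
    · exact absurd rfl hne
    · exact hnew e he
    · rw [dot_comm]
      exact hnew d hd
    · exact hw d hd e he hne
  · rw [Finset.card_insert_of_notMem hnot, hcard]
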